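/- Let G = (𝒢, Col, v₀) be an imperfect-information parity game with Nature in which Abélard does not play (V_A = ∅), and let G̃ be the associated two-player imperfect-information game without Nature. Then Éloïse has a topologically-good strategy in G if and only if she has a winning strategy in G̃. Moreover, from a winning strategy (resp. positional strategy, resp. finite-memory strategy) φ̃_E of Éloïse in G̃ one can define a topologically-good strategy (resp. positional strategy, resp. finite-memory strategy) φ_E for Éloïse in G. -/

import Mathlib

open Cardinal

/-- The three players: Éloïse, Abélard and Nature. -/
inductive Player : Type
  | E
  | A
  | N
  deriving DecidableEq

/-- An arena: a directed graph without dead-ends whose vertices are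
partitioned among the three players (via the `owner` function). -/
structure Arena (V : Type) where
  Edge : V → V → Prop
  owner : V → Player
  no_dead : ∀ v, ∃ w, Edge v w

/-- The history `[p 0, …, p i]` of a play `p` up to time `i`. -/
def histUpTo {V : Type} (p : ℕ → V) (i : ℕ) : List V :=
  List.ofFn (fun j : Fin (i + 1) => p j.1)

/-- A play from `v0`: an infinite sequence following edges. -/
def IsPlay {V : Type} (A : Arena V) (v0 : V) (p : ℕ → V) : Prop :=
  p 0 = v0 ∧ ∀ i, A.Edge (p i) (p (i + 1))

/-- The player `P` respects the strategy `φ` along the play `p`. -/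
def Respects {V : Type} (A : Arena V) (P : Player) (φ : List V → V) (p : ℕ → V) : Prop :=
  ∀ i, A.owner (p i) = P → p (i + 1) = φ (histUpTo p i)

/-- `φ` is a strategy for player `P`: on every history ending in a vertex of `P`
it prescribes a successor of that vertex. -/
def IsStrategyFor {V : Type} (A : Arena V) (P : Player) (φ : List V → V) : Prop :=
  ∀ (l : List V) (v : V), A.owner v = P → A.Edge v (φ (l ++ [v]))

/-- The set of plays from `v0` in which Éloïse respects `φE` and Abélard respects `φA`
(Nature is unconstrained). -/
def Outcomes {V : Type} (A : Arena V) (v0 : V) (φE φA : List V → V) : Set (ℕ → V) :=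
  {p | IsPlay A v0 p ∧ Respects A Player.E φE p ∧ Respects A Player.A φA p}

/-- `l` is a (finite) prefix of the infinite word `p`. -/
def BPrefix {X : Type} (p : ℕ → X) (l : List X) : Prop :=
  ∀ i : Fin l.length, p i.1 = l.get i
/-- A positional strategy only depends on the current vertex. -/
def PositionalF {V α : Type} (φ : List V → α) : Prop :=
  ∃ f : V → α, ∀ (l : List V) (v : V), φ (l ++ [v]) = f v

/-- A finite-memory strategy: implemented by a finite-state machine reading the
visited vertices. -/
def FiniteMemoryF {V α : Type} (φ : List V → α) : Prop :=
  ∃ (M : Type) (_ : Finite M) (m0 : M) (up : M → V → M) (mov : M → V → α),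
    ∀ (l : List V) (v : V), φ (l ++ [v]) = mov ((l ++ [v]).tail.foldl up m0) v
/-- The nodes of the tree of finite prefixes of a set `P` of infinite words. -/
def PrefixesOf {X : Type} (P : Set (ℕ → X)) : Set (List X) :=
  {l | ∃ p ∈ P, BPrefix p l}

/-- `B` is nowhere dense in the tree whose set of branches is `P`:
below every node there is a node through which no branch of `B` passes. -/
def NowhereDenseIn {X : Type} (P B : Set (ℕ → X)) : Prop :=
  ∀ u ∈ PrefixesOf P, ∃ v ∈ PrefixesOf P, u <+: v ∧ ∀ b ∈ B, ¬ BPrefix b v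

/-- `B` is meager in the tree whose set of branches is `P`:
a countable union of nowhere dense sets. -/
def MeagerIn {X : Type} (P B : Set (ℕ → X)) : Prop :=
  ∃ f : ℕ → Set (ℕ → X), (∀ n, NowhereDenseIn P (f n)) ∧ B ⊆ ⋃ n, f n

/-- An Éloïse strategy is topologically-good if, against every Abélard strategy,
the set of plays she loses is meager in the tree of outcomes. -/
def TopGood {V : Type} (A : Arena V) (v0 : V) (Ω : Set (ℕ → V)) (φE : List V → V) : Prop :=
  ∀ φA, IsStrategyFor A Player.A φA →
    MeagerIn (Outcomes A v0 φE φA) (Outcomes A v0 φE φA \ Ω)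
/-- An imperfect-information one-player arena with Nature: Éloïse chooses actions,
Nature resolves them. -/
structure IINArena (V : Type) (Γ : Type) where
  d : V → Γ → Set V
  d_ne : ∀ v γ, (d v γ).Nonempty
  obs : V → V → Prop
  obs_equiv : Equivalence obs

/-- An observation-based strategy: it only depends on the `obs`-class of the
history. -/
def NObsBased {V Γ α : Type} (A : IINArena V Γ) (φ : List V → α) : Prop :=
  ∀ l l', List.Forall₂ A.obs l l' → φ l = φ l'

/-- The plays from `v0` respecting the strategy `φ` (the branches of `T(v0, φ)`). -/
def NPlays {V Γ : Type} (A : IINArena V Γ) (v0 : V) (φ : List V → Γ) : Set (ℕ → V) :=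
  {p | p 0 = v0 ∧ ∀ i, p (i + 1) ∈ A.d (p i) (φ (histUpTo p i))}

/-- The parity winning condition associated with the colouring `col`. -/
def ParityWC {V : Type} (col : V → ℕ) : Set (ℕ → V) :=
  {p | Even (sInf {c | {i | col (p i) = c}.Infinite})}

/-- `φ` is topologically-good: the set of plays respecting `φ` that violate the
parity condition is meager in the tree `T(v0, φ)`. -/
def NTopGood {V Γ : Type} (A : IINArena V Γ) (v0 : V) (col : V → ℕ)
    (φ : List V → Γ) : Prop :=
  MeagerIn (NPlays A v0 φ) (NPlays A v0 φ \ ParityWC col)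

/-- The vertices of `G̃`: triples `(v, X, x)` where `X = true` means that Abélard is
currently playing in the simulated Banach–Mazur game and `x = true` means that
Éloïse's first Banach–Mazur move has been completed. -/
abbrev TVert (V : Type) : Type := V × Bool × Bool

/-- The actions of Éloïse in `G̃`: an action `γ` together with a map `θ` assigning
to each vertex a pair `((v_f, y_f), (v_n, y_n))`. -/
abbrev TAct (V Γ : Type) : Type := Γ × (V → (V × Bool) × (V × Bool))

/-- Observation-based strategies of `G̃`: `(v, X, x) ≈ (v', Y, y)` iff `obs v v'`. -/
def TildeObsBased {V Γ : Type} (A : IINArena V Γ) (φ : List (TVert V) → TAct V Γ) : Prop :=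
  ∀ l l', List.Forall₂ (fun a b : TVert V => A.obs a.1 b.1) l l' → φ l = φ l'

/-- A valid Éloïse strategy of `G̃`: the vertices prescribed by `θ` always belong to
`Δ(v, γ)`. -/
def TildeValid {V Γ : Type} (A : IINArena V Γ) (φ : List (TVert V) → TAct V Γ) : Prop :=
  ∀ (l : List (TVert V)) (v : V),
    ((φ l).2 v).1.1 ∈ A.d v (φ l).1 ∧ ((φ l).2 v).2.1 ∈ A.d v (φ l).1

/-- The unique successor of an Éloïse-tagged vertex in phase `x`, given the value
`θv` of `θ` at the current vertex: it is `(v_x, A, n)` if `y_x = ⊤` and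
`(v_x, E, x)` if `y_x = ⊥`. -/
def tildeStep {V : Type} (θv : (V × Bool) × (V × Bool)) (x : Bool) : TVert V :=
  let vx := if x then θv.2 else θv.1
  if vx.2 then (vx.1, true, true) else (vx.1, false, x)

/-- The plays of `G̃` from `(v0, A, f)` compatible with the Éloïse strategy `φ`. -/
def TildeCompat {V Γ : Type} (A : IINArena V Γ) (v0 : V)
    (φ : List (TVert V) → TAct V Γ) : Set (ℕ → TVert V) :=
  {p | p 0 = (v0, true, false) ∧ ∀ i,
    ((p i).2.1 = true →
      (p (i + 1)).1 ∈ A.d (p i).1 (φ (histUpTo p i)).1 ∧ (p (i + 1)).2.2 = (p i).2.2) ∧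
    ((p i).2.1 = false →
      p (i + 1) = tildeStep ((φ (histUpTo p i)).2 (p i).1) (p i).2.2)}

/-- The winning condition of `G̃`: either the projected play satisfies the parity
condition and Abélard plays infinitely often in the Banach–Mazur game, or from
some point on only Abélard plays there. -/
def TildeWC {V : Type} (col : V → ℕ) : Set (ℕ → TVert V) :=
  {p | ((fun i => (p i).1) ∈ ParityWC col ∧ {j | (p j).2.1 = true}.Infinite) ∨
       (∃ N, ∀ j, N ≤ j → (p j).2.1 = true)}

/-- The Éloïse strategy `φ` is winning in `G̃`. -/
def TildeWins {V Γ : Type} (A : IINArena V Γ) (v0 : V) (col : V → ℕ)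
    (φ : List (TVert V) → TAct V Γ) : Prop :=
  ∀ p ∈ TildeCompat A v0 φ, p ∈ TildeWC col
theorem hist_succ {V : Type} (p : ℕ → V) (i : ℕ) :
    histUpTo p (i + 1) = histUpTo p i ++ [p (i + 1)] := by
  unfold histUpTo
  rw [List.ofFn_succ_last]
  rfl

theorem hist_congr {V : Type} {p q : ℕ → V} {i : ℕ} (h : ∀ j, j ≤ i → p j = q j) :
    histUpTo p i = histUpTo q i := by
  unfold histUpTo
  congr 1
  funext j
  exact h j.1 (by omega)

theorem hist_map {V W : Type} (f : V → W) (p : ℕ → V) (i : ℕ) :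
    (histUpTo p i).map f = histUpTo (fun j => f (p j)) i := by
  unfold histUpTo
  rw [List.map_ofFn]
  rfl

theorem hist_last {V : Type} (p : ℕ → V) (i : ℕ) (d : V) :
    (histUpTo p i).getLast?.getD d = p i := by
  cases i with
  | zero => simp [histUpTo]
  | succ i => rw [hist_succ]; simp

theorem hist_length {V : Type} (p : ℕ → V) (i : ℕ) : (histUpTo p i).length = i + 1 := by
  simp [histUpTo]

theorem exists_seq {V : Type} (F : List V → V) :
    ∃ q : ℕ → V, q 0 = F [] ∧ ∀ j, q (j + 1) = F (histUpTo q j) := by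
  obtain ⟨L, hL0, hL⟩ : ∃ L : ℕ → List V, L 0 = [] ∧ ∀ n, L (n + 1) = L n ++ [F (L n)] :=
    ⟨fun n => Nat.rec [] (fun _ l => l ++ [F l]) n, rfl, fun _ => rfl⟩
  have h : ∀ n, histUpTo (fun j => F (L j)) n = L (n + 1) := by
    intro n
    induction n with
    | zero => simp [histUpTo, hL, hL0]
    | succ n ih => rw [hist_succ, ih, ← hL]
  refine ⟨fun j => F (L j), by simp [hL0], fun j => ?_⟩
  rw [h]

theorem exists_cont {V : Type} (p : ℕ → V) (i : ℕ) (σ : List V → V) :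
    ∃ q : ℕ → V, (∀ j, j ≤ i → q j = p j) ∧ ∀ j, i ≤ j → q (j + 1) = σ (histUpTo q j) := by
  obtain ⟨q, h0, h⟩ := exists_seq (fun l => if l.length ≤ i then p l.length else σ l)
  refine ⟨q, ?_, ?_⟩
  · intro j hj
    cases j with
    | zero => simpa using h0
    | succ j => rw [h, hist_length, if_pos hj]
  · intro j hj
    rw [h, hist_length, if_neg (by omega)]

theorem nplays_ext {V Γ : Type} {A : IINArena V Γ} {v0 : V} {φ : List V → Γ} {p q : ℕ → V}
    (hp : p ∈ NPlays A v0 φ) (i : ℕ) (h : ∀ j, j ≤ i → q j = p j)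
    (h2 : ∀ j, i ≤ j → q (j + 1) ∈ A.d (q j) (φ (histUpTo q j))) : q ∈ NPlays A v0 φ := by
  refine ⟨(h 0 (Nat.zero_le _)).trans hp.1, fun j => ?_⟩
  by_cases hj : i ≤ j
  · exact h2 j hj
  · rw [h (j + 1) (by omega), h j (by omega), hist_congr (q := p) (fun k hk => h k (by omega))]
    exact hp.2 j

theorem bprefix_ofFn {X : Type} (p q : ℕ → X) (k : ℕ) :
    BPrefix p (List.ofFn (fun j : Fin k => q j.1)) ↔ ∀ j, j < k → p j = q j := by
  unfold BPrefix
  constructor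
  · intro h j hj
    have := h ⟨j, by simpa using hj⟩
    simpa using this
  · intro h j
    have hj : j.1 < k := by simpa using j.2
    simpa using h j.1 hj

theorem bprefix_eq {X : Type} {q : ℕ → X} {l : List X} (h : BPrefix q l) :
    l = List.ofFn (fun j : Fin l.length => q j.1) := by
  apply List.ext_get
  · simp
  · intro n h1 h2
    have := h ⟨n, h1⟩
    simp at this ⊢
    exact this.symm

theorem nd_iff {X : Type} (P B : Set (ℕ → X)) :
    NowhereDenseIn P B ↔ ∀ p ∈ P, ∀ k, ∃ q ∈ P, ∃ m, k ≤ m ∧ (∀ j, j < k → q j = p j) ∧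
      ∀ b ∈ B, ¬ ∀ j, j < m → b j = q j := by
  constructor
  · intro h p hp k
    obtain ⟨v, ⟨q, hq, hqv⟩, huv, hb⟩ := h (List.ofFn (fun j : Fin k => p j.1))
      ⟨p, hp, (bprefix_ofFn _ _ _).2 (fun _ _ => rfl)⟩
    have hlen := huv.length_le
    simp at hlen
    refine ⟨q, hq, v.length, hlen, ?_, ?_⟩
    · rw [← bprefix_ofFn]
      intro i
      have hi := i.2
      have h1 := hqv ⟨i.1, lt_of_lt_of_le hi huv.length_le⟩
      rw [h1]
      simp only [List.get_eq_getElem]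
      exact (huv.getElem hi).symm
    · intro b hbB hbq
      apply hb b hbB
      rw [bprefix_eq hqv, bprefix_ofFn]
      exact hbq
  · rintro h u ⟨p, hp, hpu⟩
    obtain ⟨q, hq, m, hm, hqp, hb⟩ := h p hp u.length
    refine ⟨List.ofFn (fun j : Fin m => q j.1), ⟨q, hq, (bprefix_ofFn _ _ _).2 (fun _ _ => rfl)⟩,
      ?_, ?_⟩
    · rw [List.prefix_iff_eq_take]
      apply List.ext_getElem
      · simp [hm]
      · intro n h1 h2
        have := hpu ⟨n, h1⟩
        simp at this ⊢
        rw [hqp n h1, this]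
    · intro b hbB hbq
      rw [bprefix_ofFn] at hbq
      exact hb b hbB hbq

/-- Component of `θ` selected by the phase. -/
def selx {V : Type} (θv : (V × Bool) × (V × Bool)) (x : Bool) : V × Bool :=
  if x then θv.2 else θv.1

/-- Lift of histories. -/
def lft {V : Type} (l : List V) : List (TVert V) := l.map (fun v => (v, true, false))

/-- Selection at time `j`. -/
def selAt {V Γ : Type} (φt : List (TVert V) → TAct V Γ) (x : Bool) (q : ℕ → V) (j : ℕ) : V × Bool :=
  selx ((φt (lft (histUpTo q j))).2 (q j)) x

/-- `q` follows the strategy on `[i, k]` in phase `x`. -/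
def Sg {V Γ : Type} (φt : List (TVert V) → TAct V Γ) (x : Bool) (q : ℕ → V) (i k : ℕ) : Prop :=
  i < k ∧ ∀ j, i ≤ j → j < k → q (j + 1) = (selAt φt x q j).1 ∧
    ((selAt φt x q j).2 = true ↔ j + 1 = k)

theorem selAt_congr {V Γ : Type} (φt : List (TVert V) → TAct V Γ) (x : Bool) {p q : ℕ → V} {j : ℕ}
    (h : ∀ i, i ≤ j → p i = q i) : selAt φt x p j = selAt φt x q j := by
  unfold selAt
  rw [hist_congr h, h j le_rfl]

theorem Sg_congr {V Γ : Type} {φt : List (TVert V) → TAct V Γ} {x : Bool} {p q : ℕ → V} {i k : ℕ}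
    (h : ∀ j, j ≤ k → p j = q j) (hs : Sg φt x p i k) : Sg φt x q i k := by
  refine ⟨hs.1, fun j h1 h2 => ?_⟩
  have := hs.2 j h1 h2
  rwa [selAt_congr φt x (q := q) (fun i hi => h i (by omega)), h (j + 1) (by omega)] at this

theorem lift_eq {V Γ : Type} {A : IINArena V Γ} {φt : List (TVert V) → TAct V Γ}
    (ho : TildeObsBased A φt) (t : ℕ → TVert V) (j : ℕ) :
    φt (histUpTo t j) = φt (lft (histUpTo (fun i => (t i).1) j)) := by
  apply ho
  unfold lft
  rw [← hist_map (fun a : TVert V => a.1) t j, List.forall₂_map_right_iff,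
    List.forall₂_map_right_iff, List.forall₂_same]
  intro a _
  exact A.obs_equiv.refl _

theorem tildeStep_eq {V : Type} (θv : (V × Bool) × (V × Bool)) (x : Bool) :
    tildeStep θv x = ((selx θv x).1, (selx θv x).2, x || (selx θv x).2) := by
  obtain ⟨⟨a, b⟩, ⟨c, d⟩⟩ := θv
  cases x <;> cases b <;> cases d <;> simp [tildeStep, selx]

theorem compat_of {V Γ : Type} {A : IINArena V Γ} {v0 : V} {φt : List (TVert V) → TAct V Γ}
    (ho : TildeObsBased A φt) {q : ℕ → V} (hq : q ∈ NPlays A v0 (fun l => (φt (lft l)).1))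
    (X x : ℕ → Bool) (hX : X 0 = true) (hx : x 0 = false)
    (hA : ∀ j, X j = true → x (j + 1) = x j)
    (hE : ∀ j, X j = false → q (j + 1) = (selAt φt (x j) q j).1 ∧
      X (j + 1) = (selAt φt (x j) q j).2 ∧ x (j + 1) = (x j || (selAt φt (x j) q j).2)) :
    (fun j => (q j, X j, x j)) ∈ TildeCompat A v0 φt := by
  refine ⟨by simp [hX, hx, hq.1], fun i => ⟨fun h => ?_, fun h => ?_⟩⟩
  · rw [lift_eq ho]
    exact ⟨hq.2 i, hA i h⟩
  · rw [lift_eq ho]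
    obtain ⟨h1, h2, h3⟩ := hE i h
    change (q (i + 1), X (i + 1), x (i + 1)) = tildeStep ((φt (lft (histUpTo q i))).2 (q i)) (x i)
    rw [h1, h2, h3, tildeStep_eq]
    rfl

theorem exists_follow {V Γ : Type} {A : IINArena V Γ} {v0 : V} {φt : List (TVert V) → TAct V Γ}
    (hv : TildeValid A φt) {p : ℕ → V} (hp : p ∈ NPlays A v0 (fun l => (φt (lft l)).1)) (i : ℕ)
    (x : Bool) : ∃ q ∈ NPlays A v0 (fun l => (φt (lft l)).1), (∀ j, j ≤ i → q j = p j) ∧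
      ∀ j, i ≤ j → q (j + 1) = (selAt φt x q j).1 := by
  obtain ⟨q, h1, h2⟩ := exists_cont p i
    (fun l => (selx ((φt (lft l)).2 (l.getLast?.getD v0)) x).1)
  have h3 : ∀ j, i ≤ j → q (j + 1) = (selAt φt x q j).1 := by
    intro j hj
    rw [h2 j hj, hist_last]
    rfl
  refine ⟨q, nplays_ext hp i h1 ?_, h1, h3⟩
  intro j hj
  rw [h3 j hj]
  unfold selAt selx
  have := hv (lft (histUpTo q j)) (q j)
  split_ifs
  · exact this.2
  · exact this.1

theorem exists_Sg {V Γ : Type} {φt : List (TVert V) → TAct V Γ} {q : ℕ → V} {i : ℕ} {x : Bool}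
    (h : ∀ j, i ≤ j → q (j + 1) = (selAt φt x q j).1)
    (h2 : ∃ j, i ≤ j ∧ (selAt φt x q j).2 = true) : ∃ k, Sg φt x q i k := by
  classical
  have h3 := Nat.find_spec h2
  refine ⟨Nat.find h2 + 1, by omega, fun j hj hjk => ⟨h j hj, ?_⟩⟩
  constructor
  · intro h4
    have := Nat.find_min' h2 ⟨hj, h4⟩
    omega
  · intro h4
    have : j = Nat.find h2 := by omega
    rw [this]; exact h3.2

theorem term_f {V Γ : Type} {A : IINArena V Γ} {v0 : V} {col : V → ℕ}
    {φt : List (TVert V) → TAct V Γ}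
    (ho : TildeObsBased A φt) (hw : TildeWins A v0 col φt)
    {q : ℕ → V} (hq : q ∈ NPlays A v0 (fun l => (φt (lft l)).1)) {i : ℕ} (hi : 1 ≤ i)
    (h : ∀ j, i ≤ j → q (j + 1) = (selAt φt false q j).1) : ∃ k, Sg φt false q i k := by
  apply exists_Sg h
  by_contra hc
  push Not at hc
  have hcm := compat_of ho hq (fun j => decide (j < i)) (fun _ => false) (by simp; omega) rfl
    (by simp) (by
      intro j hj
      simp at hj
      have := hc j hj
      simp at this
      refine ⟨h j hj, ?_, ?_⟩
      · simp [this]; omega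
      · simp [this])
  rcases hw _ hcm with ⟨_, h2⟩ | ⟨N, h2⟩
  · apply h2
    apply (Set.finite_lt_nat i).subset
    intro j hj
    simpa using hj
  · have := h2 (max N i) (le_max_left _ _)
    simp at this

theorem term_n {V Γ : Type} {A : IINArena V Γ} {v0 : V} {col : V → ℕ}
    {φt : List (TVert V) → TAct V Γ}
    (ho : TildeObsBased A φt) (hw : TildeWins A v0 col φt)
    {q : ℕ → V} (hq : q ∈ NPlays A v0 (fun l => (φt (lft l)).1)) {a b i : ℕ} (ha : 1 ≤ a)
    (hs : Sg φt false q a b) (hi : b < i)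
    (h : ∀ j, i ≤ j → q (j + 1) = (selAt φt true q j).1) : ∃ k, Sg φt true q i k := by
  apply exists_Sg h
  by_contra hc
  push Not at hc
  have hab := hs.1
  have hcm := compat_of ho hq (fun j => decide (j < a ∨ (b ≤ j ∧ j < i))) (fun j => decide (b ≤ j))
    (by simp; omega) (by simp; omega)
    (by
      intro j hj
      simp at hj ⊢
      omega) (by
      intro j hj
      simp at hj
      by_cases hij : i ≤ j
      · have hy := hc j hij
        simp at hy
        have hb : b ≤ j := by omega
        simp only [hb, decide_true, hy]
        refine ⟨h j hij, ?_, ?_⟩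
        · simp; omega
        · simp; omega
      · have hjb : j < b := by omega
        have hb : ¬ b ≤ j := by omega
        have hy := hs.2 j hj.1 hjb
        simp only [hb, decide_false]
        refine ⟨hy.1, ?_, ?_⟩
        · rw [Bool.eq_iff_iff, hy.2]; simp; omega
        · rw [Bool.false_or, Bool.eq_iff_iff, hy.2]; simp; omega)
  rcases hw _ hcm with ⟨_, h2⟩ | ⟨N, h2⟩
  · apply h2
    apply (Set.finite_lt_nat i).subset
    intro j hj
    simp at hj ⊢
    omega
  · have := h2 (max N i) (le_max_left _ _)
    simp at this
    omega

theorem win_inf {V Γ : Type} {A : IINArena V Γ} {v0 : V} {col : V → ℕ}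
    {φt : List (TVert V) → TAct V Γ}
    (ho : TildeObsBased A φt) (hw : TildeWins A v0 col φt)
    {q : ℕ → V} (hq : q ∈ NPlays A v0 (fun l => (φt (lft l)).1)) {a b : ℕ} (ha : 1 ≤ a)
    (hs : Sg φt false q a b) (h : ∀ m, b ≤ m → ∃ i k, m < i ∧ Sg φt true q i k) :
    q ∈ ParityWC col := by
  have h' : ∀ m, ∃ i k, max b m < i ∧ Sg φt true q i k := fun m => h _ (le_max_left _ _)
  choose I K hI hS using h'
  have hab := hs.1
  -- s n : starting bound
  obtain ⟨s, hs1⟩ : ∃ s : ℕ → ℕ, ∀ n, s (n + 1) = K (s n) :=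
    ⟨fun n => Nat.rec b (fun _ m => K m) n, fun _ => rfl⟩
  have hIK : ∀ m, I m < K m := fun m => (hS m).1
  have hIm : ∀ m, m < I m := fun m => lt_of_le_of_lt (le_max_right _ _) (hI m)
  have hIb : ∀ m, b < I m := fun m => lt_of_le_of_lt (le_max_left _ _) (hI m)
  have hsm : StrictMono s := strictMono_nat_of_lt_succ (fun n => by
    rw [hs1]; exact (hIm _).trans (hIK _))
  let Ep : ℕ → Prop := fun j => (a ≤ j ∧ j < b) ∨ ∃ n, I (s n) ≤ j ∧ j < K (s n)
  have hK : ∀ n n', I (s n') ≤ K (s n) → K (s n) < K (s n') → False := by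
    intro n n' h1 h2
    rw [← hs1, ← hs1] at h2
    have h3 := hsm.lt_iff_lt.1 h2
    have h4 : s (n + 1) ≤ s n' := hsm.monotone (by omega)
    have := hIm (s n')
    rw [← hs1] at h1
    omega
  classical
  have hcm := compat_of ho hq (fun j => decide (¬ Ep j)) (fun j => decide (b ≤ j))
    (by
      simp only [decide_eq_true_eq]
      rintro (h1 | ⟨n, h1, h2⟩)
      · omega
      · have := hIb (s n); omega)
    (by simp; omega)
    (by
      intro j hj
      simp only [decide_eq_true_eq] at hj
      have : ¬ (a ≤ j ∧ j < b) := fun h => hj (Or.inl h)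
      simp
      omega)
    (by
      intro j hj
      simp only [decide_eq_false_iff_not, not_not] at hj
      rcases hj with ⟨h1, h2⟩ | ⟨n, h1, h2⟩
      · have hb : ¬ b ≤ j := by omega
        have hy := hs.2 j h1 h2
        simp only [hb, decide_false]
        refine ⟨hy.1, ?_, ?_⟩
        · rw [Bool.eq_iff_iff, hy.2, decide_eq_true_eq]
          constructor
          · intro h3
            by_contra h4
            exact h3 (Or.inl ⟨by omega, by omega⟩)
          · rintro h3 (h4 | ⟨n, h4, h5⟩)
            · omega
            · have := hIb (s n); omega
        · rw [Bool.false_or, Bool.eq_iff_iff, hy.2]; simp; omega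
      · have hb : b ≤ j := by have := hIb (s n); omega
        have hb' : b ≤ j + 1 := by omega
        have hy := (hS (s n)).2 j h1 h2
        simp only [hb, hb', decide_true]
        refine ⟨hy.1, ?_, ?_⟩
        · rw [Bool.eq_iff_iff, hy.2, decide_eq_true_eq]
          constructor
          · intro h3
            by_contra h4
            exact h3 (Or.inr ⟨n, by omega, by omega⟩)
          · rintro h3 (h4 | ⟨n', h4, h5⟩)
            · omega
            · rw [h3] at h4 h5
              exact hK n n' h4 h5
        · simp)
  rcases hw _ hcm with ⟨h1, _⟩ | ⟨N, h2⟩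
  · exact h1
  · exfalso
    have h3 := h2 (I (s N)) (by
      have := hIm (s N)
      have := hsm.id_le N
      simp at this
      omega)
    simp only [decide_eq_true_eq] at h3
    exact h3 (Or.inr ⟨N, le_rfl, hIK _⟩)

theorem good_of_wins {V Γ : Type} {A : IINArena V Γ} {v0 : V} {col : V → ℕ}
    {φt : List (TVert V) → TAct V Γ}
    (ho : TildeObsBased A φt) (hv : TildeValid A φt) (hw : TildeWins A v0 col φt) :
    NTopGood A v0 col (fun l => (φt (lft l)).1) := by
  let G : ℕ → Set (ℕ → V) := fun n => Nat.rec {p | ¬ ∃ a b, 1 ≤ a ∧ Sg φt false p a b}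
    (fun m _ => {p | (∃ a b, 1 ≤ a ∧ b ≤ m ∧ Sg φt false p a b) ∧
      ∀ i k, m < i → ¬ Sg φt true p i k}) n
  refine ⟨G, ?_, ?_⟩
  · intro n
    rw [nd_iff]
    intro p hp k
    cases n with
    | zero =>
      obtain ⟨q, hq, hqp, hf⟩ := exists_follow hv hp (max k 1) false
      obtain ⟨m, hm⟩ := term_f ho hw hq (le_max_right _ _) hf
      have hm1 := hm.1
      refine ⟨q, hq, m + 1, by omega, fun j hj => hqp j (by omega), ?_⟩
      intro b hb hbq
      exact hb ⟨max k 1, m, le_max_right _ _,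
        Sg_congr (fun j hj => (hbq j (by omega)).symm) hm⟩
    | succ n =>
      by_cases hc : ∃ a b, 1 ≤ a ∧ b ≤ n ∧ Sg φt false p a b
      · obtain ⟨a, b, ha, hbn, hs⟩ := hc
        obtain ⟨q, hq, hqp, hf⟩ := exists_follow hv hp (max k (n + 1)) true
        have hs' : Sg φt false q a b := Sg_congr (fun j hj => (hqp j (by omega)).symm) hs
        obtain ⟨m, hm⟩ := term_n ho hw hq ha hs' (by omega) hf
        have hm1 := hm.1
        refine ⟨q, hq, m + 1, by omega, fun j hj => hqp j (by omega), ?_⟩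
        intro b hb hbq
        exact hb.2 (max k (n + 1)) m (by omega)
          (Sg_congr (fun j hj => (hbq j (by omega)).symm) hm)
      · refine ⟨p, hp, max k (n + 1), le_max_left _ _, fun _ _ => rfl, ?_⟩
        intro b hb hbq
        obtain ⟨⟨a, b', ha, hbn, hs⟩, _⟩ := hb
        exact hc ⟨a, b', ha, hbn, Sg_congr (fun j hj => hbq j (by omega)) hs⟩
  · rintro p ⟨hp, hpc⟩
    by_contra hno
    simp only [Set.mem_iUnion, not_exists] at hno
    have h0 := hno 0
    have h0' : ∃ a b, 1 ≤ a ∧ Sg φt false p a b := not_not.1 h0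
    obtain ⟨a, b, ha, hs⟩ := h0'
    apply hpc
    apply win_inf ho hw hp ha hs
    intro m hm
    by_contra hc
    push Not at hc
    exact hno (m + 1) ⟨⟨a, b, ha, hm, hs⟩, hc⟩

theorem part2 {V Γ : Type} {A : IINArena V Γ} {v0 : V} {col : V → ℕ}
    (φt : List (TVert V) → TAct V Γ)
    (ho : TildeObsBased A φt) (hv : TildeValid A φt) (hw : TildeWins A v0 col φt) :
    ∃ φ : List V → Γ, NObsBased A φ ∧ NTopGood A v0 col φ ∧
        (PositionalF φt → PositionalF φ) ∧
        (FiniteMemoryF φt → FiniteMemoryF φ) := by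
  refine ⟨fun l => (φt (lft l)).1, ?_, good_of_wins ho hv hw, ?_, ?_⟩
  · intro l l' h
    have : φt (lft l) = φt (lft l') := by
      apply ho
      unfold lft
      rw [List.forall₂_map_right_iff, List.forall₂_map_left_iff]
      exact h
    simp only [this]
  · rintro ⟨f, hf⟩
    refine ⟨fun v => (f (v, true, false)).1, fun l v => ?_⟩
    simp [lft, hf]
  · rintro ⟨M, hM, m0, up, mov, h⟩
    refine ⟨M, hM, m0, fun m v => up m (v, true, false), fun m v => (mov m (v, true, false)).1,
      fun l v => ?_⟩
    have := h (lft l) (v, true, false)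
    simp only [lft, List.map_append, List.map_cons, List.map_nil] at this ⊢
    rw [this]
    congr 2
    rw [show l.map (fun v => ((v, true, false) : TVert V)) ++ [(v, true, false)]
      = (l ++ [v]).map (fun v => ((v, true, false) : TVert V)) by simp, ← List.map_tail,
      List.foldl_map]

/-- The tree of continuations from observed history `l` and current vertex `v`. -/
def Tr {V Γ : Type} (A : IINArena V Γ) (φ : List V → Γ) : List V → V → List V → Prop
  | _, _, [] => True
  | l, v, a :: w => a ∈ A.d v (φ l) ∧ Tr A φ (l ++ [a]) a w

/-- Subtree. -/
def Dr {V : Type} (S : List V → Prop) (w : List V) : List V → Prop := fun w' => S (w ++ w')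

/-- Colours in a tree. -/
def Cl {V : Type} (col : V → ℕ) (S : List V → Prop) : Set ℕ :=
  {c | ∃ w a, S (w ++ [a]) ∧ col a = c}

/-- Stable trees. -/
def Stb {V : Type} (col : V → ℕ) (S : List V → Prop) : Prop :=
  ∀ w, S w → Cl col (Dr S w) = Cl col S

theorem Tr_congr {V Γ : Type} {A : IINArena V Γ} {φ : List V → Γ} (ho : NObsBased A φ)
    (w : List V) : ∀ (l l' : List V) (v : V), List.Forall₂ A.obs l l' →
      Tr A φ l v w = Tr A φ l' v w := by
  induction w with
  | nil => intros; rfl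
  | cons a w ih =>
    intro l l' v h
    unfold Tr
    rw [ho l l' h, ih (l ++ [a]) (l' ++ [a]) a
      (List.rel_append h (List.Forall₂.cons (A.obs_equiv.refl a) List.Forall₂.nil))]

theorem Dr_append {V : Type} (S : List V → Prop) (w w' : List V) :
    Dr S (w ++ w') = Dr (Dr S w) w' := by
  funext u
  simp [Dr]

theorem Cl_Dr {V : Type} (col : V → ℕ) (S : List V → Prop) (w : List V) :
    Cl col (Dr S w) ⊆ Cl col S := by
  rintro c ⟨u, a, h, rfl⟩
  exact ⟨w ++ u, a, by simpa [Dr] using h, rfl⟩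

theorem Stb_Dr {V : Type} {col : V → ℕ} {S : List V → Prop} (h : Stb col S) {w : List V}
    (hw : S w) : Stb col (Dr S w) := by
  intro u hu
  rw [← Dr_append, h _ hu, h _ hw]

theorem exists_stb {V : Type} {col : V → ℕ} (hf : (Set.range col).Finite) {S : List V → Prop}
    (h : ∃ a, S [a]) : ∃ w, w ≠ [] ∧ S w ∧ Stb col (Dr S w) := by
  have hfin : ∀ S : List V → Prop, (Cl col S).Finite := fun S => hf.subset (by
    rintro c ⟨w, a, _, rfl⟩; exact ⟨a, rfl⟩)
  obtain ⟨a, ha⟩ := h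
  classical
  have hex : ∃ n, ∃ w, w ≠ [] ∧ S w ∧ (Cl col (Dr S w)).ncard = n := ⟨_, [a], by simp, ha, rfl⟩
  obtain ⟨w, hw, hSw, hn⟩ := Nat.find_spec hex
  refine ⟨w, hw, hSw, ?_⟩
  intro u hu
  apply Set.eq_of_subset_of_ncard_le (Cl_Dr _ _ _) _ (hfin _)
  rw [hn]
  apply Nat.find_min' hex
  exact ⟨w ++ u, by simp [hw], hu, by rw [Dr_append]⟩

theorem exists_pick {V : Type} [Nonempty V] (S W : List V → Prop)
    (hW : ∀ w, W w → w ≠ [] ∧ S w) :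
    ∃ r : V × Bool, (∃ a, S [a]) → (∀ a w, S (a :: w) → S [a]) →
      S [r.1] ∧ ((∃ w, W w) → ∃ w', W (r.1 :: w') ∧ (r.2 = true ↔ w' = []) ∧
        ∀ u, W u → w'.length + 1 ≤ u.length) := by
  classical
  by_cases hex : ∃ w, W w
  · have hex' : ∃ n, ∃ w, W w ∧ w.length = n := by
      obtain ⟨w, hw⟩ := hex
      exact ⟨_, w, hw, rfl⟩
    obtain ⟨w, hw, hn⟩ := Nat.find_spec hex'
    have hmin : ∀ u, W u → w.length ≤ u.length := by
      intro u hu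
      rw [hn]
      exact Nat.find_min' hex' ⟨u, hu, rfl⟩
    cases w with
    | nil => exact absurd rfl (hW _ hw).1
    | cons a w =>
      refine ⟨(a, decide (w = [])), fun _ hc => ⟨hc _ _ (hW _ hw).2, fun _ => ⟨w, hw, by simp, ?_⟩⟩⟩
      intro u hu
      simpa using hmin u hu
  · by_cases ha : ∃ a, S [a]
    · obtain ⟨a, ha⟩ := ha
      exact ⟨(a, false), fun _ _ => ⟨ha, fun h => absurd h hex⟩⟩
    · exact ⟨(Classical.arbitrary V, false), fun h => absurd h ha⟩

/-- Goal words in the first phase. -/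
def Wf {V : Type} (col : V → ℕ) (S : List V → Prop) (w : List V) : Prop :=
  w ≠ [] ∧ S w ∧ Stb col (Dr S w)

/-- Goal words in the next phases. -/
def Wn {V : Type} (col : V → ℕ) (S : List V → Prop) (w : List V) : Prop :=
  w ≠ [] ∧ S w ∧ ∃ u a, w = u ++ [a] ∧ col a = sInf (Cl col S)

theorem Tr_head {V Γ : Type} {A : IINArena V Γ} {φ : List V → Γ} {l : List V} {v a : V}
    {w : List V} (h : Tr A φ l v (a :: w)) : Tr A φ l v [a] := ⟨h.1, trivial⟩

theorem Tr_ne {V Γ : Type} (A : IINArena V Γ) (φ : List V → Γ) (l : List V) (v : V) :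
    ∃ a, Tr A φ l v [a] := by
  obtain ⟨a, ha⟩ := A.d_ne v (φ l)
  exact ⟨a, ha, trivial⟩

/-- The tree at time `i` of a play. -/
def TrAt {V Γ : Type} (A : IINArena V Γ) (φ : List V → Γ) (q : ℕ → V) (i : ℕ) : List V → Prop :=
  Tr A φ (histUpTo q i) (q i)

theorem TrAt_congr {V Γ : Type} (A : IINArena V Γ) (φ : List V → Γ) {p q : ℕ → V} {i : ℕ}
    (h : ∀ j, j ≤ i → p j = q j) : TrAt A φ p i = TrAt A φ q i := by
  unfold TrAt
  rw [hist_congr h, h i le_rfl]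

theorem TrAt_mem {V Γ : Type} {A : IINArena V Γ} {φ : List V → Γ} {v0 : V} {q : ℕ → V}
    (hq : q ∈ NPlays A v0 φ) (i : ℕ) : TrAt A φ q i [q (i + 1)] := ⟨hq.2 i, trivial⟩

theorem TrAt_succ {V Γ : Type} {A : IINArena V Γ} {φ : List V → Γ} {v0 : V} {q : ℕ → V}
    (hq : q ∈ NPlays A v0 φ) (i : ℕ) : TrAt A φ q (i + 1) = Dr (TrAt A φ q i) [q (i + 1)] := by
  funext w
  apply propext
  unfold TrAt Dr
  rw [hist_succ]
  constructor
  · intro h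
    exact ⟨hq.2 i, h⟩
  · intro h
    exact h.2

theorem stb_later {V Γ : Type} {A : IINArena V Γ} {φ : List V → Γ} {v0 : V} {q : ℕ → V}
    {col : V → ℕ} (hq : q ∈ NPlays A v0 φ) {i : ℕ} (h : Stb col (TrAt A φ q i)) (n : ℕ) :
    Stb col (TrAt A φ q (i + n)) ∧ Cl col (TrAt A φ q (i + n)) = Cl col (TrAt A φ q i) := by
  induction n with
  | zero => exact ⟨h, rfl⟩
  | succ n ih =>
    rw [← Nat.add_assoc, TrAt_succ hq]
    exact ⟨Stb_Dr ih.1 (TrAt_mem hq _), (ih.1 _ (TrAt_mem hq _)).trans ih.2⟩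

theorem col_mem {V Γ : Type} {A : IINArena V Γ} {φ : List V → Γ} {v0 : V} {q : ℕ → V}
    {col : V → ℕ} (hq : q ∈ NPlays A v0 φ) (i : ℕ) : col (q (i + 1)) ∈ Cl col (TrAt A φ q i) :=
  ⟨[], q (i + 1), TrAt_mem hq i, rfl⟩

theorem parity_eq {V Γ : Type} {A : IINArena V Γ} {φ : List V → Γ} {v0 : V} {q : ℕ → V}
    {col : V → ℕ} (hq : q ∈ NPlays A v0 φ) {i : ℕ} (h : Stb col (TrAt A φ q i))
    (hinf : ∀ N, ∃ j, N ≤ j ∧ col (q j) = sInf (Cl col (TrAt A φ q i))) :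
    sInf {c | {j | col (q j) = c}.Infinite} = sInf (Cl col (TrAt A φ q i)) := by
  have hmem : sInf (Cl col (TrAt A φ q i)) ∈ {c | {j | col (q j) = c}.Infinite} := by
    change Set.Infinite _
    rw [Set.infinite_iff_exists_gt]
    intro N
    obtain ⟨j, hj, hc⟩ := hinf (N + 1)
    exact ⟨j, hc, by omega⟩
  apply le_antisymm (Nat.sInf_le hmem)
  apply le_csInf ⟨_, hmem⟩
  intro c hc
  change Set.Infinite _ at hc
  rw [Set.infinite_iff_exists_gt] at hc
  obtain ⟨j, hj, hij⟩ := hc i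
  apply Nat.sInf_le
  obtain ⟨n, rfl⟩ : ∃ n, j = i + n + 1 := ⟨j - i - 1, by omega⟩
  rw [← (stb_later hq h n).2, ← hj]
  exact col_mem hq _

theorem follow_word {V Γ : Type} {A : IINArena V Γ} {φ : List V → Γ} {v0 : V} {col : V → ℕ}
    (w : List V) : ∀ (p : ℕ → V), p ∈ NPlays A v0 φ → ∀ (k : ℕ) (a : V),
      TrAt A φ p k (w ++ [a]) →
      ∃ q ∈ NPlays A v0 φ, (∀ j, j ≤ k → q j = p j) ∧ ∃ j, k < j ∧ q j = a := by
  have one : ∀ (p : ℕ → V), p ∈ NPlays A v0 φ → ∀ (k : ℕ) (a : V), a ∈ A.d (p k) (φ (histUpTo p k))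
      → ∃ q ∈ NPlays A v0 φ, (∀ j, j ≤ k → q j = p j) ∧ q (k + 1) = a := by
    intro p hp k a ha
    choose g hg using A.d_ne
    obtain ⟨q, h1, h2⟩ := exists_cont p k
      (fun l => if l.length = k + 1 then a else g (l.getLast?.getD v0) (φ l))
    have hk : q (k + 1) = a := by rw [h2 k le_rfl, hist_length, if_pos rfl]
    refine ⟨q, nplays_ext hp k h1 ?_, h1, hk⟩
    intro j hj
    by_cases hjk : j = k
    · subst hjk
      rw [hk, h1 j le_rfl, hist_congr (q := p) h1]
      exact ha
    · rw [h2 j hj, hist_length, if_neg (by omega), hist_last]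
      exact hg _ _
  induction w with
  | nil =>
    intro p hp k a h
    obtain ⟨q, hq, h1, h2⟩ := one p hp k a h.1
    exact ⟨q, hq, h1, k + 1, by omega, h2⟩
  | cons b w ih =>
    intro p hp k a h
    obtain ⟨q, hq, h1, h2⟩ := one p hp k b h.1
    have h3 : TrAt A φ q (k + 1) (w ++ [a]) := by
      rw [TrAt_succ hq, h2, TrAt_congr A φ h1]
      exact h
    obtain ⟨r, hr, h4, j, hj, h5⟩ := ih q hq (k + 1) a h3
    exact ⟨r, hr, fun i hi => (h4 i (by omega)).trans (h1 i hi), j, by omega, h5⟩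

theorem baire {V Γ : Type} {A : IINArena V Γ} {φ : List V → Γ} {v0 : V} {q : ℕ → V}
    {col : V → ℕ} (hg : NTopGood A v0 col φ) (hq : q ∈ NPlays A v0 φ) {i : ℕ}
    (h : Stb col (TrAt A φ q i)) : Even (sInf (Cl col (TrAt A φ q i))) := by
  obtain ⟨f, hf, hsub⟩ := hg
  set c := sInf (Cl col (TrAt A φ q i)) with hc
  -- states
  let St := {s : (ℕ → V) × ℕ // s.1 ∈ NPlays A v0 φ ∧ i < s.2 ∧ ∀ j, j ≤ i → s.1 j = q j}
  have step : ∀ (n : ℕ) (s : St), ∃ t : St, s.1.2 < t.1.2 ∧ (∀ j, j < s.1.2 → t.1.1 j = s.1.1 j) ∧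
      (∀ b ∈ f n, ¬ ∀ j, j < t.1.2 → b j = t.1.1 j) ∧
      ∃ j, s.1.2 ≤ j ∧ j < t.1.2 ∧ col (t.1.1 j) = c := by
    rintro n ⟨⟨p, k⟩, hp, hik, hpq⟩
    simp only at hp hik hpq
    obtain ⟨p', hp', m, hkm, hpp, hb⟩ := (nd_iff _ _).1 (hf n) p hp k
    have hS : Stb col (TrAt A φ p' i) := by
      rw [TrAt_congr A φ (q := q) (fun j hj => (hpp j (by omega)).trans (hpq j hj))]; exact h
    have hcl : Cl col (TrAt A φ p' m) = Cl col (TrAt A φ q i) := by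
      obtain ⟨d, rfl⟩ : ∃ d, m = i + d := ⟨m - i, by omega⟩
      rw [(stb_later hp' hS d).2,
        TrAt_congr A φ (q := q) (fun j hj => (hpp j (by omega)).trans (hpq j hj))]
    have hcm : c ∈ Cl col (TrAt A φ p' m) := by
      rw [hcl]
      exact Nat.sInf_mem ⟨_, col_mem hq i⟩
    obtain ⟨w, a, hw, hac⟩ := hcm
    obtain ⟨r, hr, hrp, j, hj, hja⟩ := follow_word (col := col) w p' hp' m a hw
    refine ⟨⟨(r, j + 1), hr, by simp only; omega, fun l hl => ?_⟩, by simp only; omega, fun l hl => ?_, ?_, j,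
      by simp only; omega, by simp, by simp only [hja, hac]⟩
    · change r l = q l
      rw [hrp l (by omega), hpp l (by omega), hpq l hl]
    · simp only at hl ⊢
      rw [hrp l (by omega), hpp l (by omega)]
    · intro b hbf hbr
      apply hb b hbf
      intro l hl
      rw [hbr l (by simp only; omega)]
      exact hrp l (by omega)
  choose F hF1 hF2 hF3 hF4 using step
  obtain ⟨s, hs⟩ : ∃ s : ℕ → St, ∀ n, s (n + 1) = F n (s n) :=
    ⟨fun n => Nat.rec ⟨(q, i + 1), hq, by simp, fun _ _ => rfl⟩ (fun n s => F n s) n, fun _ => rfl⟩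
  have hlen : StrictMono (fun n => (s n).1.2) := strictMono_nat_of_lt_succ (fun n => by
    rw [hs]; exact hF1 n (s n))
  have hle : ∀ n, n ≤ (s n).1.2 := fun n => hlen.id_le n
  have hag : ∀ n d j, j < (s n).1.2 → (s (n + d)).1.1 j = (s n).1.1 j := by
    intro n d j hj
    induction d with
    | zero => rfl
    | succ d ih =>
      rw [← Nat.add_assoc, hs, hF2 _ _ _ (lt_of_lt_of_le hj (hlen.monotone (by omega))), ih]
  let r : ℕ → V := fun j => (s (j + 1)).1.1 j
  have hr : ∀ n j, j < (s n).1.2 → r j = (s n).1.1 j := by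
    intro n j hj
    change (s (j + 1)).1.1 j = _
    rcases le_total n (j + 1) with h1 | h1
    · obtain ⟨d, hd⟩ := Nat.exists_eq_add_of_le h1
      rw [hd]
      exact hag n d j hj
    · obtain ⟨d, rfl⟩ := Nat.exists_eq_add_of_le h1
      exact (hag (j + 1) d j (hle (j + 1))).symm
  have hrP : r ∈ NPlays A v0 φ := by
    constructor
    · rw [hr 1 0 (hle 1)]
      exact (s 1).2.1.1
    · intro j
      have h1 : ∀ l, l ≤ j + 1 → r l = (s (j + 2)).1.1 l := fun l hl =>
        hr (j + 2) l (lt_of_lt_of_le (by omega) (hle (j + 2)))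
      rw [h1 (j + 1) le_rfl, h1 j (by omega), hist_congr (fun l hl => h1 l (by omega))]
      exact (s (j + 2)).2.1.2 j
  have hri : ∀ j, j ≤ i → r j = q j := by
    intro j hj
    rw [hr 0 j (lt_of_le_of_lt hj (s 0).2.2.1)]
    exact (s 0).2.2.2 j hj
  have hT : TrAt A φ r i = TrAt A φ q i := TrAt_congr A φ hri
  have hpar := parity_eq hrP (i := i) (col := col) (by rw [hT]; exact h) (by
    intro N
    obtain ⟨j, h1, h2, h3⟩ := hF4 N (s N)
    rw [← hs] at h2 h3
    refine ⟨j, (hle N).trans h1, ?_⟩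
    rw [hr _ _ h2, h3, hT])
  by_contra hodd
  have hrn : r ∈ NPlays A v0 φ \ ParityWC col := by
    refine ⟨hrP, fun h2 => hodd ?_⟩
    change Even _ at h2
    rw [hpar, hT] at h2
    exact h2
  obtain ⟨n, hn⟩ := Set.mem_iUnion.1 (hsub hrn)
  refine hF3 n (s n) r hn ?_
  rw [← hs]
  intro j hj
  exact hr _ j hj

theorem descent {V : Type} (W : ℕ → List V → Prop) (i : ℕ) (h : ∃ w, W i w)
    (step : ∀ j, i ≤ j → (∃ w, W j w) → ∃ w', W (j + 1) w' ∧ ∀ u, W j u → w'.length + 1 ≤ u.length) :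
    False := by
  have key : ∀ n j, i ≤ j → (∃ w, W j w ∧ w.length ≤ n) → False := by
    intro n
    induction n with
    | zero =>
      rintro j hj ⟨w, hw, hl⟩
      obtain ⟨w', _, h2⟩ := step j hj ⟨w, hw⟩
      have := h2 w hw
      omega
    | succ n ih =>
      rintro j hj ⟨w, hw, hl⟩
      obtain ⟨w', h1, h2⟩ := step j hj ⟨w, hw⟩
      have := h2 w hw
      exact ih (j + 1) (by omega) ⟨w', h1, by omega⟩
  obtain ⟨w, hw⟩ := h
  exact key w.length i le_rfl ⟨w, hw, le_rfl⟩

theorem part1 {V Γ : Type} {A : IINArena V Γ} {v0 : V}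
    {col : V → ℕ} (hcolfin : (Set.range col).Finite) {φ : List V → Γ}
    (ho : NObsBased A φ) (hg : NTopGood A v0 col φ) :
    ∃ φt : List (TVert V) → TAct V Γ,
        TildeObsBased A φt ∧ TildeValid A φt ∧ TildeWins A v0 col φt := by
  haveI : Nonempty V := ⟨v0⟩
  have e1 := fun S : List V → Prop => exists_pick S (Wf col S) (fun w h => ⟨h.1, h.2.1⟩)
  have e2 := fun S : List V → Prop => exists_pick S (Wn col S) (fun w h => ⟨h.1, h.2.1⟩)
  choose pf hpf using e1
  choose pn hpn using e2
  have hpf' := fun l v => hpf (Tr A φ l v) (Tr_ne A φ l v) (fun a w => Tr_head)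
  have hpn' := fun l v => hpn (Tr A φ l v) (Tr_ne A φ l v) (fun a w => Tr_head)
  refine ⟨fun l => (φ (l.map (fun a => a.1)),
    fun v => (pf (Tr A φ (l.map (fun a => a.1)) v), pn (Tr A φ (l.map (fun a => a.1)) v))),
    ?_, ?_, ?_⟩
  · intro l l' h
    have h' : List.Forall₂ A.obs (l.map (fun a => a.1)) (l'.map (fun a => a.1)) := by
      rw [List.forall₂_map_right_iff, List.forall₂_map_left_iff]
      exact h
    have h2 : ∀ v, Tr A φ (l.map (fun a => a.1)) v = Tr A φ (l'.map (fun a => a.1)) v :=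
      fun v => funext fun w => Tr_congr ho w _ _ v h'
    simp only [h2, ho _ _ h']
  · intro l v
    exact ⟨(hpf' _ v).1.1, (hpn' _ v).1.1⟩
  · rintro p ⟨hp0, hp⟩
    obtain ⟨q, hqdef⟩ : ∃ q : ℕ → V, q = fun i => (p i).1 := ⟨_, rfl⟩
    have hqi : ∀ i, (p i).1 = q i := fun i => by rw [hqdef]
    have hhist : ∀ i, (histUpTo p i).map (fun a => a.1) = histUpTo q i := by
      intro i; rw [hist_map, hqdef]
    simp only [hhist, hqi] at hp
    have hpE : ∀ i, (p i).2.1 = false →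
        p (i + 1) = tildeStep (pf (TrAt A φ q i), pn (TrAt A φ q i)) (p i).2.2 :=
      fun i => (hp i).2
    have hsel : ∀ i, (p i).2.1 = false →
        q (i + 1) = (selx (pf (TrAt A φ q i), pn (TrAt A φ q i)) (p i).2.2).1 ∧
        (p (i + 1)).2.1 = (selx (pf (TrAt A φ q i), pn (TrAt A φ q i)) (p i).2.2).2 ∧
        (p (i + 1)).2.2 = ((p i).2.2 ||
          (selx (pf (TrAt A φ q i), pn (TrAt A φ q i)) (p i).2.2).2) := by
      intro i hi
      rw [← hqi, hpE i hi, tildeStep_eq]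
      exact ⟨rfl, rfl, rfl⟩
    have hpfq := fun i => hpf' (histUpTo q i) (q i)
    have hpnq := fun i => hpn' (histUpTo q i) (q i)
    change ∀ i, TrAt A φ q i _ ∧ ((∃ w, Wf col (TrAt A φ q i) w) →
      ∃ w', Wf col (TrAt A φ q i) ((pf (TrAt A φ q i)).1 :: w') ∧
      ((pf (TrAt A φ q i)).2 = true ↔ w' = []) ∧ ∀ u, Wf col (TrAt A φ q i) u → _) at hpfq
    change ∀ i, TrAt A φ q i _ ∧ ((∃ w, Wn col (TrAt A φ q i) w) →
      ∃ w', Wn col (TrAt A φ q i) ((pn (TrAt A φ q i)).1 :: w') ∧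
      ((pn (TrAt A φ q i)).2 = true ↔ w' = []) ∧ ∀ u, Wn col (TrAt A φ q i) u → _) at hpnq
    have hq : q ∈ NPlays A v0 φ := by
      refine ⟨by rw [← hqi, hp0], fun i => ?_⟩
      cases hX : (p i).2.1 with
      | true => exact ((hp i).1 hX).1
      | false =>
        rw [(hsel i hX).1]
        unfold selx
        split_ifs
        · exact (hpnq i).1.1
        · exact (hpfq i).1.1
    have hexf : ∀ i, ∃ w, Wf col (TrAt A φ q i) w := fun i =>
      exists_stb hcolfin ⟨_, TrAt_mem hq i⟩
    have hexn : ∀ i, ∃ w, Wn col (TrAt A φ q i) w := by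
      intro i
      obtain ⟨w, a, h1, h2⟩ := Nat.sInf_mem (s := Cl col (TrAt A φ q i)) ⟨_, col_mem hq i⟩
      exact ⟨w ++ [a], by simp, h1, w, a, rfl, h2⟩
    -- invariant
    have hmono : ∀ i, (p i).2.2 = true → (p (i + 1)).2.2 = true := by
      intro i hi
      cases hX : (p i).2.1 with
      | true => rw [((hp i).1 hX).2, hi]
      | false => rw [(hsel i hX).2.2, hi]; rfl
    have hstb : ∀ i, (p i).2.2 = true → Stb col (TrAt A φ q i) := by
      intro i
      induction i with
      | zero => intro h; rw [hp0] at h; cases h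
      | succ i ih =>
        intro h
        cases hx : (p i).2.2 with
        | true => exact (stb_later hq (ih hx) 1).1
        | false =>
          cases hX : (p i).2.1 with
          | true =>
            have := ((hp i).1 hX).2
            rw [hx, h] at this
            cases this
          | false =>
            obtain ⟨h1, h2, h3⟩ := hsel i hX
            rw [hx, h] at h3
            rw [hx] at h1
            simp [selx] at h1 h3
            obtain ⟨w', hw, hiff, _⟩ := (hpfq i).2 (hexf i)
            rw [hiff.1 h3] at hw
            rw [TrAt_succ hq, h1]
            exact hw.2.2
    by_cases hev : ∃ N, ∀ j, N ≤ j → (p j).2.1 = true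
    · exact Or.inr hev
    left
    push Not at hev
    have hsw : ∀ N, ∃ k, N ≤ k ∧ (p k).2.1 = false ∧ (p (k + 1)).2.1 = true := by
      intro N
      by_contra hcon
      push Not at hcon
      obtain ⟨j, hNj, hj⟩ := hev N
      have hE : ∀ k, j ≤ k → (p k).2.1 = false := by
        intro k hk
        induction k, hk using Nat.le_induction with
        | base => simpa using hj
        | succ k hk ih => simpa using hcon k (by omega) ih
      have hxc : ∀ k, j ≤ k → (p k).2.2 = (p j).2.2 := by
        intro k hk
        induction k, hk using Nat.le_induction with
        | base => rfl
        | succ k hk ih =>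
          have h1 := (hsel k (hE k hk)).2.2
          rw [← (hsel k (hE k hk)).2.1, hE (k + 1) (by omega), Bool.or_false] at h1
          rw [h1, ih]
      cases hx : (p j).2.2 with
      | false =>
        refine descent (fun i => Wf col (TrAt A φ q i)) j (hexf j) ?_
        intro k hk _
        obtain ⟨w', hw, hiff, hmin⟩ := (hpfq k).2 (hexf k)
        obtain ⟨h1, h2, _⟩ := hsel k (hE k hk)
        rw [hxc k hk, hx] at h1 h2
        simp [selx] at h1 h2
        refine ⟨w', ⟨?_, ?_, ?_⟩, hmin⟩
        · intro hnil
          rw [hiff.2 hnil, hE (k + 1) (by omega)] at h2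
          cases h2
        · rw [TrAt_succ hq, h1]; exact hw.2.1
        · rw [TrAt_succ hq, h1, ← Dr_append]; exact hw.2.2
      | true =>
        refine descent (fun i => Wn col (TrAt A φ q i)) j (hexn j) ?_
        intro k hk _
        obtain ⟨w', hw, hiff, hmin⟩ := (hpnq k).2 (hexn k)
        obtain ⟨h1, h2, _⟩ := hsel k (hE k hk)
        rw [hxc k hk, hx] at h1 h2
        simp [selx] at h1 h2
        have hne : w' ≠ [] := by
          intro hnil
          rw [hiff.2 hnil, hE (k + 1) (by omega)] at h2
          cases h2
        refine ⟨w', ⟨hne, ?_, ?_⟩, hmin⟩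
        · rw [TrAt_succ hq, h1]; exact hw.2.1
        · obtain ⟨u, a, hu, ha⟩ := hw.2.2
          rw [(stb_later hq (hstb k (by rw [hxc k hk, hx])) 1).2]
          cases u with
          | nil => simp at hu; exact absurd hu.2 hne
          | cons b u =>
            simp at hu
            exact ⟨u, a, hu.2, ha⟩
    obtain ⟨k0, _, hk0E, hk0A⟩ := hsw 0
    have hx0 : (p (k0 + 1)).2.2 = true := by
      rw [(hsel k0 hk0E).2.2, ← (hsel k0 hk0E).2.1, hk0A, Bool.or_true]
    have hxN : ∀ k, k0 + 1 ≤ k → (p k).2.2 = true := by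
      intro k hk
      induction k, hk using Nat.le_induction with
      | base => exact hx0
      | succ k hk ih => exact hmono k ih
    have hst := hstb _ hx0
    constructor
    · have hpar := parity_eq hq hst (by
        intro N
        obtain ⟨k, hk, hkE, hkA⟩ := hsw (max N (k0 + 1))
        refine ⟨k + 1, by omega, ?_⟩
        obtain ⟨w', hw, hiff, hmin⟩ := (hpnq k).2 (hexn k)
        obtain ⟨h1, h2, _⟩ := hsel k hkE
        rw [hxN k (by omega)] at h1 h2
        simp [selx] at h1 h2
        rw [hkA] at h2
        obtain ⟨u, a, hu, ha⟩ := hw.2.2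
        rw [hiff.1 h2.symm] at hu
        have hu' : u = [] ∧ a = q (k + 1) := by
          cases u with
          | nil => simp at hu; exact ⟨rfl, by rw [h1, hu]⟩
          | cons b u => simp at hu
        rw [← hu'.2, ha]
        obtain ⟨d, rfl⟩ : ∃ d, k = k0 + 1 + d := ⟨k - (k0 + 1), by omega⟩
        rw [(stb_later hq hst d).2])
      rw [← hqdef]
      change Even _
      rw [hpar]
      exact baire hg hq hst
    · rw [Set.infinite_iff_exists_gt]
      intro N
      obtain ⟨k, hk, _, hkA⟩ := hsw N
      exact ⟨k + 1, hkA, by omega⟩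

/-- In an imperfect-information parity game with Nature in which
Abélard does not play, Éloïse has a topologically-good strategy iff she has an
(observation-based, valid) winning strategy in the associated two-player
imperfect-information game `G̃`; moreover from a winning (resp. positional, resp.
finite-memory) strategy in `G̃` one can define a topologically-good
(resp. positional, resp. finite-memory) observation-based strategy in `G`. -/
theorem stmt13 {V Γ : Type} [Countable V] (A : IINArena V Γ) (v0 : V)
    (col : V → ℕ) (hcolfin : (Set.range col).Finite)
    (hcolobs : ∀ v w, A.obs v w → col v = col w) :
    ((∃ φ : List V → Γ, NObsBased A φ ∧ NTopGood A v0 col φ) ↔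
      ∃ φt : List (TVert V) → TAct V Γ,
        TildeObsBased A φt ∧ TildeValid A φt ∧ TildeWins A v0 col φt) ∧
    (∀ φt : List (TVert V) → TAct V Γ,
      TildeObsBased A φt → TildeValid A φt → TildeWins A v0 col φt →
      ∃ φ : List V → Γ, NObsBased A φ ∧ NTopGood A v0 col φ ∧
        (PositionalF φt → PositionalF φ) ∧
        (FiniteMemoryF φt → FiniteMemoryF φ)) := by
  refine ⟨⟨?_, ?_⟩, ?_⟩
  · rintro ⟨φ, ho, hg⟩
    exact part1 hcolfin ho hg
  · rintro ⟨φt, ho, hv, hw⟩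
    obtain ⟨φ, h1, h2, _⟩ := part2 φt ho hv hw
    exact ⟨φ, h1, h2⟩
  · intro φt ho hv hw
    exact part2 φt ho hv hw
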